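/- There exists a universal constant C such that the following holds: for every x ∈ Z^4, every pair of disjoint sets A, B ⊆ Z^4, and every finite simple path γ of length n ≥ 0 from x to A which does not intersect B, the simple random walk X on Z^4 started at x satisfies P_x( |τ_A − T_{A,B}(γ)| > λn | τ_A < ∞, τ_A < τ_B, LE(X^{τ_A}) = γ ) ≤ C/λ for every λ ≥ 1. -/

import Mathlib

open MeasureTheory Filter Set
open scoped ENNReal Classical Topology

noncomputable section

abbrev V4 : Type := Fin 4 → ℤ

/-- Nearest-neighbour adjacency in `ℤ⁴`. -/
def latAdj (x y : V4) : Prop := ∑ i, |x i - y i| = 1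

/-- `μ` is the family of laws of the simple random walk on `ℤ⁴`: `μ x` is the law on path
space `ℕ → ℤ⁴` of the walk started at `x`, characterised by its cylinder probabilities. -/
def IsSRW4 (μ : V4 → Measure (ℕ → V4)) : Prop :=
  (∀ x, IsProbabilityMeasure (μ x)) ∧
  ∀ (x : V4) (n : ℕ) (γ : ℕ → V4),
    μ x {ω | ∀ k ≤ n, ω k = γ k} =
      (if γ 0 = x then 1 else 0) *
        ∏ k ∈ Finset.range n, (if latAdj (γ k) (γ (k + 1)) then (8 : ℝ≥0∞)⁻¹ else 0)

open scoped ProbabilityTheory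

/-- The hitting time of `A` by the path `ω`, with value `⊤` if `A` is never hit. -/
def hitTime (A : Set V4) (ω : ℕ → V4) : ℕ∞ := ⨅ (n : ℕ) (_ : ω n ∈ A), (n : ℕ∞)

/-- The times `ℓ_i` of the loop-erasure of the path `ω` stopped at time `m`:
`ℓ_0 = 0` and `ℓ_{i+1} = 1 + max{k ≤ m : ω_k = ω_{ℓ_i}}`. -/
def ellFin (ω : ℕ → V4) (m : ℕ) : ℕ → ℕ
  | 0 => 0
  | i + 1 => sSup {k | k ≤ m ∧ ω k = ω (ellFin ω m i)} + 1

/-- The length of the loop-erasure of the path `ω` stopped at time `m`. -/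
def leLen (ω : ℕ → V4) (m : ℕ) : ℕ := sInf {i | ellFin ω m (i + 1) = m + 1}

/-- The event that `ω` hits `A` in finite time, before hitting `B`, and that the
loop-erasure of the stopped path coincides with the path `γ` of length `n`. -/
def leEvent (A B : Set V4) (n : ℕ) (γ : ℕ → V4) : Set (ℕ → V4) :=
  {ω | hitTime A ω ≠ ⊤ ∧ hitTime A ω < hitTime B ω ∧
    leLen ω (hitTime A ω).toNat = n ∧
    ∀ i ≤ n, ω (ellFin ω (hitTime A ω).toNat i) = γ i}

/-- The `(A,B)`-typical time of the simple path `γ` of length `n` started at `x`: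
`T_{A,B}(γ) = E_x[Σ_{i=1}^{n} ((ℓ_i - ℓ_{i-1}) ∧ n) | τ_A < ∞, τ_A < τ_B, LE(X^{τ_A}) = γ]`. -/
def typicalTime (μ : V4 → Measure (ℕ → V4)) (x : V4) (A B : Set V4)
    (n : ℕ) (γ : ℕ → V4) : ℝ :=
  ∫ ω, (∑ i ∈ Finset.Icc 1 n,
      (min (ellFin ω (hitTime A ω).toNat i - ellFin ω (hitTime A ω).toNat (i - 1)) n : ℝ))
    ∂((μ x)[|leEvent A B n γ])


/-! ### Heat kernel bound by Fourier inversion -/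

/-- The uniform probability measure on `(0, π]`. -/
def angleMeasure : Measure ℝ := ENNReal.ofReal (Real.pi⁻¹) • volume.restrict (Ioc 0 Real.pi)

lemma integral_angleMeasure (f : ℝ → ℝ) :
    ∫ t, f t ∂angleMeasure = Real.pi⁻¹ * ∫ t in (0 : ℝ)..Real.pi, f t := by
  rw [angleMeasure, integral_smul_measure, intervalIntegral.integral_of_le Real.pi_pos.le,
    ENNReal.toReal_ofReal (inv_nonneg.2 Real.pi_pos.le), smul_eq_mul]

instance : IsProbabilityMeasure angleMeasure := by
  constructor
  simp only [angleMeasure, Measure.smul_apply, Measure.restrict_apply_univ, Real.volume_Ioc,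
    sub_zero, smul_eq_mul]
  rw [← ENNReal.ofReal_mul (inv_nonneg.2 Real.pi_pos.le), inv_mul_cancel₀ Real.pi_ne_zero,
    ENNReal.ofReal_one]

lemma integral_cos_int_mul_angleMeasure (k : ℤ) :
    ∫ t, Real.cos (k * t) ∂angleMeasure = if k = 0 then 1 else 0 := by
  rw [integral_angleMeasure]
  split_ifs with h
  · simp [h, Real.pi_ne_zero]
  · have hk : (k : ℝ) ≠ 0 := by exact_mod_cast h
    rw [intervalIntegral.integral_comp_mul_left (fun t => Real.cos t) hk]
    simp [integral_cos, Real.sin_int_mul_pi]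

/-- The characteristic function of the step of simple random walk on `ℤ⁴`. -/
def charFn (θ : Fin 4 → ℝ) : ℝ := (∑ i, Real.cos (θ i)) / 4

/-- The Fourier representation of the heat kernel of simple random walk on `ℤ⁴`. -/
def heat (m : ℕ) (v : V4) : ℝ :=
  ∫ θ, charFn θ ^ m * ∏ j, Real.cos (v j * θ j) ∂(Measure.pi fun _ : Fin 4 => angleMeasure)

lemma abs_charFn_le (θ : Fin 4 → ℝ) : |charFn θ| ≤ (∑ i, |Real.cos (θ i)|) / 4 := by
  rw [charFn, abs_div, abs_of_pos (by norm_num : (0 : ℝ) < 4)]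
  gcongr
  exact Finset.abs_sum_le_sum_abs _ _

lemma abs_charFn_le_one (θ : Fin 4 → ℝ) : |charFn θ| ≤ 1 := by
  refine (abs_charFn_le θ).trans ?_
  have : ∑ i, |Real.cos (θ i)| ≤ ∑ _i : Fin 4, (1 : ℝ) :=
    Finset.sum_le_sum fun i _ => Real.abs_cos_le_one _
  simp at this
  linarith

lemma integrable_heat (m : ℕ) (v : V4) :
    Integrable (fun θ : Fin 4 → ℝ => charFn θ ^ m * ∏ j, Real.cos (v j * θ j))
      (Measure.pi fun _ : Fin 4 => angleMeasure) := by
  refine Integrable.of_bound (C := 1) ?_ (Eventually.of_forall fun θ => ?_)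
  · refine Continuous.aestronglyMeasurable ?_
    unfold charFn
    fun_prop
  · rw [norm_mul, norm_pow, norm_prod, Real.norm_eq_abs]
    refine mul_le_one₀ (pow_le_one₀ (abs_nonneg _) (abs_charFn_le_one θ))
      (Finset.prod_nonneg fun _ _ => norm_nonneg _)
      (Finset.prod_le_one (fun _ _ => norm_nonneg _) fun i _ => Real.abs_cos_le_one _)

lemma heat_zero (v : V4) : heat 0 v = if v = 0 then 1 else 0 := by
  have : heat 0 v = ∏ j, ∫ t, Real.cos (v j * t) ∂angleMeasure := by
    simp only [heat, pow_zero, one_mul]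
    exact integral_fintype_prod_eq_prod (μ := fun _ => angleMeasure)
      (fun j t => Real.cos (v j * t))
  rw [this]
  simp only [integral_cos_int_mul_angleMeasure]
  split_ifs with h
  · simp [h]
  · obtain ⟨j, hj⟩ := Function.ne_iff.1 h
    exact Finset.prod_eq_zero (Finset.mem_univ j) (if_neg hj)

lemma prod_cos_add_single (θ : Fin 4 → ℝ) (v : V4) (i : Fin 4) :
    (∏ j, Real.cos (((v + Pi.single i 1 : V4) j : ℝ) * θ j)) +
      ∏ j, Real.cos (((v - Pi.single i 1 : V4) j : ℝ) * θ j) =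
      2 * Real.cos (θ i) * ∏ j, Real.cos (v j * θ j) := by
  have key : ∀ w : V4, (∀ j, j ≠ i → w j = v j) → ∏ j, Real.cos (w j * θ j) =
      Real.cos (w i * θ i) * ∏ j ∈ Finset.univ.erase i, Real.cos (v j * θ j) := by
    intro w hw
    rw [← Finset.mul_prod_erase _ _ (Finset.mem_univ i)]
    congr 1
    exact Finset.prod_congr rfl fun j hj => by rw [hw j (Finset.ne_of_mem_erase hj)]
  rw [key v fun _ _ => rfl, key (v + Pi.single i 1) fun j hj => by simp [hj],
    key (v - Pi.single i 1) fun j hj => by simp [hj]]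
  simp only [Pi.add_apply, Pi.sub_apply, Pi.single_eq_same, Int.cast_add, Int.cast_sub,
    Int.cast_one, add_mul, sub_mul, one_mul, Real.cos_add, Real.cos_sub]
  ring

lemma heat_succ (m : ℕ) (v : V4) :
    heat (m + 1) v =
      ∑ i, (heat m (v + Pi.single i 1) + heat m (v - Pi.single i 1)) / 8 := by
  rw [← Finset.sum_div, eq_div_iff (by norm_num)]
  have hsum : ∀ i : Fin 4, heat m (v + Pi.single i 1) + heat m (v - Pi.single i 1) =
      ∫ θ, charFn θ ^ m * (2 * Real.cos (θ i) * ∏ j, Real.cos (v j * θ j))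
        ∂(Measure.pi fun _ : Fin 4 => angleMeasure) := by
    intro i
    rw [heat, heat, ← integral_add (integrable_heat m _) (integrable_heat m _)]
    congr 1
    ext θ
    rw [← mul_add, prod_cos_add_single]
  have hint : ∀ i : Fin 4, Integrable
      (fun θ : Fin 4 → ℝ => charFn θ ^ m * (2 * Real.cos (θ i) * ∏ j, Real.cos (v j * θ j)))
      (Measure.pi fun _ : Fin 4 => angleMeasure) := by
    intro i
    refine ((integrable_heat m (v + Pi.single i 1)).add
      (integrable_heat m (v - Pi.single i 1))).congr (Eventually.of_forall fun θ => ?_)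
    simp only
    rw [← prod_cos_add_single, mul_add]
    rfl
  rw [Finset.sum_congr rfl fun i _ => hsum i, ← integral_finsetSum _ fun i _ => hint i, heat,
    ← integral_mul_const]
  congr 1
  ext θ
  rw [← Finset.mul_sum, ← Finset.sum_mul, ← Finset.mul_sum, pow_succ, charFn]
  ring

lemma heat_nonneg (m : ℕ) (v : V4) : 0 ≤ heat m v := by
  induction m generalizing v with
  | zero => rw [heat_zero]; split_ifs <;> norm_num
  | succ m ih =>
    rw [heat_succ]
    exact Finset.sum_nonneg fun i _ => div_nonneg (add_nonneg (ih _) (ih _)) (by norm_num)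

lemma abs_cos_pow_bound {t : ℝ} (ht : t ∈ Ioc 0 Real.pi) (m : ℕ) :
    Real.exp (-(m * (1 - |Real.cos t|) / 4)) ≤
      Real.exp 1 * (Real.exp (-((m + 1) / (2 * Real.pi ^ 2)) * t ^ 2) +
        Real.exp (-((m + 1) / (2 * Real.pi ^ 2)) * (t - Real.pi) ^ 2)) := by
  have hc0 := abs_nonneg (Real.cos t)
  have hc1 := Real.abs_cos_le_one t
  have hsq : |Real.cos t| ^ 2 + |Real.sin t| ^ 2 = 1 := by
    rw [sq_abs, sq_abs, Real.cos_sq_add_sin_sq]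
  have aux : ∀ s : ℝ, |s| ≤ Real.pi / 2 → |Real.sin s| = |Real.sin t| →
      Real.exp (-(m * (1 - |Real.cos t|) / 4)) ≤
        Real.exp 1 * Real.exp (-((m + 1) / (2 * Real.pi ^ 2)) * s ^ 2) := by
    intro s hs hst
    rw [← Real.exp_add, Real.exp_le_exp]
    have h1 := Real.mul_abs_le_abs_sin hs
    rw [hst] at h1
    have h2 : (2 / Real.pi * |s|) ^ 2 ≤ |Real.sin t| ^ 2 := by
      have := Real.pi_pos
      gcongr
    have h3 : s ^ 2 / (2 * Real.pi ^ 2) = (2 / Real.pi * |s|) ^ 2 / 8 := by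
      rw [mul_pow, sq_abs]; field_simp; norm_num
    have h4 : -(((m : ℝ) + 1) / (2 * Real.pi ^ 2)) * s ^ 2 =
      -((m + 1) * (s ^ 2 / (2 * Real.pi ^ 2))) := by ring
    rw [h4, h3]
    have hm : (0 : ℝ) ≤ m := Nat.cast_nonneg m
    nlinarith [mul_nonneg hm (by nlinarith :
      (0 : ℝ) ≤ 2 * (1 - |Real.cos t|) - (2 / Real.pi * |s|) ^ 2)]
  have e1 := Real.exp_pos (-(((m : ℝ) + 1) / (2 * Real.pi ^ 2)) * t ^ 2)
  have e2 := Real.exp_pos (-(((m : ℝ) + 1) / (2 * Real.pi ^ 2)) * (t - Real.pi) ^ 2)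
  have e3 := Real.exp_pos 1
  rcases le_total t (Real.pi / 2) with h | h
  · have := aux t (by rw [abs_of_pos ht.1]; exact h) rfl
    nlinarith [mul_pos e3 e2]
  · have := aux (t - Real.pi) (by rw [abs_le]; constructor <;> linarith [ht.2, Real.pi_pos])
      (by rw [Real.sin_sub_pi, abs_neg])
    nlinarith [mul_pos e3 e1]

lemma integral_abs_cos_bound (m : ℕ) :
    ∫ t, Real.exp (-(m * (1 - |Real.cos t|) / 4)) ∂angleMeasure ≤
      Real.pi⁻¹ * (Real.exp 1 * (2 * √(Real.pi / ((m + 1) / (2 * Real.pi ^ 2))))) := by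
  have hb : (0 : ℝ) < (m + 1) / (2 * Real.pi ^ 2) := by positivity
  set b : ℝ := (m + 1) / (2 * Real.pi ^ 2) with hbdef
  have i1 : Integrable fun t : ℝ => Real.exp (-b * t ^ 2) := integrable_exp_neg_mul_sq hb
  have i2 : Integrable fun t : ℝ => Real.exp (-b * (t - Real.pi) ^ 2) :=
    i1.comp_sub_right Real.pi
  rw [integral_angleMeasure, intervalIntegral.integral_of_le Real.pi_pos.le]
  have hpi := Real.pi_pos
  gcongr
  calc ∫ t in Ioc 0 Real.pi, Real.exp (-(m * (1 - |Real.cos t|) / 4))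
      ≤ ∫ t in Ioc 0 Real.pi, Real.exp 1 *
          (Real.exp (-b * t ^ 2) + Real.exp (-b * (t - Real.pi) ^ 2)) := by
        refine setIntegral_mono_on ?_ ((i1.add i2).const_mul _).integrableOn measurableSet_Ioc
          fun t ht => abs_cos_pow_bound ht m
        exact (Continuous.integrableOn_Icc (by fun_prop)).mono_set Ioc_subset_Icc_self
    _ ≤ ∫ t, Real.exp 1 *
          (Real.exp (-b * t ^ 2) + Real.exp (-b * (t - Real.pi) ^ 2)) :=
        setIntegral_le_integral ((i1.add i2).const_mul _)
          (Eventually.of_forall fun t => by positivity)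
    _ = Real.exp 1 * (2 * √(Real.pi / b)) := by
        rw [integral_const_mul, integral_add i1 i2,
          integral_sub_right_eq_self (fun t => Real.exp (-b * t ^ 2)) Real.pi, integral_gaussian]
        ring

lemma heat_origin_le :
    ∃ C : ℝ, 0 < C ∧ ∀ m : ℕ, heat m 0 ≤ C / ((m : ℝ) + 1) ^ 2 := by
  refine ⟨(Real.pi⁻¹ * (Real.exp 1 * 2)) ^ 4 * (Real.pi * (2 * Real.pi ^ 2)) ^ 2,
    by have := Real.pi_pos; positivity, fun m => ?_⟩
  have h1 : heat m 0 ≤ (∫ t, Real.exp (-(m * (1 - |Real.cos t|) / 4)) ∂angleMeasure) ^ 4 := by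
    have h2 : (∫ t, Real.exp (-(m * (1 - |Real.cos t|) / 4)) ∂angleMeasure) ^ 4 =
        ∫ θ : Fin 4 → ℝ, ∏ j, Real.exp (-(m * (1 - |Real.cos (θ j)|) / 4))
          ∂(Measure.pi fun _ : Fin 4 => angleMeasure) := by
      rw [integral_fintype_prod_eq_prod (μ := fun _ : Fin 4 => angleMeasure)
        (fun _ t => Real.exp (-(m * (1 - |Real.cos t|) / 4)))]
      simp
    rw [h2]
    refine integral_mono (integrable_heat m 0) ?_ fun θ => ?_
    · refine Integrable.of_bound (C := 1) (Continuous.aestronglyMeasurable (by fun_prop))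
        (Eventually.of_forall fun θ => ?_)
      rw [norm_prod]
      refine Finset.prod_le_one (fun _ _ => norm_nonneg _) fun i _ => ?_
      rw [Real.norm_eq_abs, Real.abs_exp, Real.exp_le_one_iff, neg_nonpos]
      have := Real.abs_cos_le_one (θ i)
      have : 0 ≤ 1 - |Real.cos (θ i)| := by linarith
      positivity
    · simp only [Pi.zero_apply, Int.cast_zero, zero_mul, Real.cos_zero, Finset.prod_const_one,
        mul_one]
      rw [← Real.exp_sum]
      calc charFn θ ^ m ≤ |charFn θ| ^ m := by
            rw [← abs_pow]; exact le_abs_self _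
        _ ≤ Real.exp (|charFn θ| - 1) ^ m := by
            gcongr
            linarith [Real.add_one_le_exp (|charFn θ| - 1)]
        _ = Real.exp (m * (|charFn θ| - 1)) := (Real.exp_nat_mul _ _).symm
        _ ≤ _ := by
            rw [Real.exp_le_exp]
            have h3 := abs_charFn_le θ
            have h4 : ∑ i, -(m * (1 - |Real.cos (θ i)|) / 4) =
                m * ((∑ i, |Real.cos (θ i)|) / 4 - 1) := by
              simp only [Fin.sum_univ_four]; ring
            rw [h4]
            gcongr
  refine h1.trans ((pow_le_pow_left₀ (integral_nonneg fun t => (Real.exp_pos _).le)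
    (integral_abs_cos_bound m) 4).trans (le_of_eq ?_))
  have h5 : √(Real.pi / ((m + 1) / (2 * Real.pi ^ 2))) ^ 4 =
      (Real.pi / ((m + 1) / (2 * Real.pi ^ 2))) ^ 2 := by
    rw [show (4 : ℕ) = 2 * 2 from rfl, pow_mul, Real.sq_sqrt (by have := Real.pi_pos; positivity)]
  rw [show ∀ a b c : ℝ, (a * (b * (2 * c))) ^ 4 = (a * (b * 2)) ^ 4 * c ^ 4 by intros; ring, h5]
  field_simp

/-! ### The Markov property -/

/-- The path with its first step removed. -/
def shiftPath (ω : ℕ → V4) : ℕ → V4 := fun k => ω (k + 1)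

lemma measurable_shiftPath : Measurable shiftPath :=
  measurable_pi_lambda _ fun k => measurable_pi_apply (k + 1)

lemma measurable_shiftPath_iterate (m : ℕ) :
    Measurable fun (ω : ℕ → V4) k => ω (k + m) :=
  measurable_pi_lambda _ fun k => measurable_pi_apply (k + m)

lemma measurableSet_coord (k : ℕ) (D : Set V4) : MeasurableSet {ω : ℕ → V4 | ω k ∈ D} :=
  measurable_pi_apply k MeasurableSet.of_discrete

lemma measurableSet_coord_eq (k : ℕ) (y : V4) : MeasurableSet {ω : ℕ → V4 | ω k = y} :=
  measurableSet_coord k {y}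

/-- The event of following `γ` for `n` steps. -/
def pathCylinder (n : ℕ) (γ : ℕ → V4) : Set (ℕ → V4) := {ω | ∀ k ≤ n, ω k = γ k}

lemma measurableSet_pathCylinder (n : ℕ) (γ : ℕ → V4) : MeasurableSet (pathCylinder n γ) := by
  have : pathCylinder n γ = ⋂ k, ⋂ (_ : k ≤ n), {ω | ω k = γ k} := by
    ext ω; simp [pathCylinder]
  rw [this]
  exact MeasurableSet.iInter fun k => MeasurableSet.iInter fun _ => measurableSet_coord_eq k _

lemma isPiSystem_pathCylinder :
    IsPiSystem {s : Set (ℕ → V4) | ∃ n γ, s = pathCylinder n γ} := by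
  rintro _ ⟨n, γ, rfl⟩ _ ⟨m, δ, rfl⟩ ⟨ω, hω, hω'⟩
  refine ⟨max n m, ω, ?_⟩
  ext η
  simp only [pathCylinder, mem_inter_iff, mem_ofPred_eq] at hω hω' ⊢
  constructor
  · rintro ⟨h1, h2⟩ k hk
    rcases le_max_iff.1 hk with h | h
    · rw [h1 k h, hω k h]
    · rw [h2 k h, hω' k h]
  · exact fun h => ⟨fun k hk => by rw [h k (le_max_of_le_left hk), hω k hk],
      fun k hk => by rw [h k (le_max_of_le_right hk), hω' k hk]⟩

lemma generateFrom_pathCylinder :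
    (inferInstance : MeasurableSpace (ℕ → V4)) =
      MeasurableSpace.generateFrom {s | ∃ n γ, s = pathCylinder n γ} := by
  apply le_antisymm
  · refine iSup_le fun k => ?_
    rw [← measurable_iff_comap_le]
    refine @measurable_to_countable' V4 (ℕ → V4) _ _
      (MeasurableSpace.generateFrom {s | ∃ n γ, s = pathCylinder n γ}) _ fun y => ?_
    have : (fun ω : ℕ → V4 => ω k) ⁻¹' {y} =
        ⋃ δ : {δ : Fin (k + 1) → V4 // δ (Fin.last k) = y},
          pathCylinder k fun i => if h : i < k + 1 then δ.1 ⟨i, h⟩ else 0 := by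
      ext ω
      simp only [mem_preimage, mem_singleton_iff, mem_iUnion, pathCylinder, mem_ofPred_eq]
      constructor
      · exact fun h => ⟨⟨fun i => ω i, by simpa using h⟩, fun i hi => by
          rw [dif_pos (Nat.lt_succ_of_le hi)]⟩
      · rintro ⟨δ, h⟩
        rw [h k le_rfl, dif_pos (Nat.lt_succ_self k)]
        exact δ.2
    rw [this]
    exact MeasurableSet.iUnion fun δ => MeasurableSpace.measurableSet_generateFrom ⟨_, _, rfl⟩
  · refine MeasurableSpace.generateFrom_le ?_
    rintro _ ⟨n, γ, rfl⟩
    exact measurableSet_pathCylinder n γ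

section SimpleRandomWalk

variable {μ : V4 → Measure (ℕ → V4)}

/-- The one-step transition probability of simple random walk on `ℤ⁴`. -/
def stepProb (x y : V4) : ℝ≥0∞ := if latAdj x y then 8⁻¹ else 0

lemma IsSRW4.cylinder (hμ : IsSRW4 μ) (x : V4) (n : ℕ) (γ : ℕ → V4) :
    μ x (pathCylinder n γ) =
      (if γ 0 = x then 1 else 0) * ∏ k ∈ Finset.range n, stepProb (γ k) (γ (k + 1)) :=
  hμ.2 x n γ

lemma IsSRW4.start (hμ : IsSRW4 μ) (x : V4) : μ x {ω | ω 0 = x} = 1 := by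
  have := hμ.cylinder x 0 fun _ => x
  simpa [pathCylinder] using this

lemma IsSRW4.ae_start (hμ : IsSRW4 μ) (x : V4) : ∀ᵐ ω ∂(μ x), ω 0 = x := by
  have := hμ.1 x
  exact (prob_compl_eq_zero_iff (measurableSet_coord_eq 0 x)).2 (hμ.start x)

lemma IsSRW4.cylinder_shift (hμ : IsSRW4 μ) (x : V4) (n : ℕ) (γ : ℕ → V4) :
    (μ x).map shiftPath (pathCylinder n γ) =
      stepProb x (γ 0) * ∏ k ∈ Finset.range n, stepProb (γ k) (γ (k + 1)) := by
  rw [Measure.map_apply measurable_shiftPath (measurableSet_pathCylinder n γ)]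
  have h1 : μ x (pathCylinder (n + 1) fun k => Nat.casesOn k x γ) =
      (if x = x then 1 else 0) *
        ((∏ k ∈ Finset.range n, stepProb (γ k) (γ (k + 1))) * stepProb x (γ 0)) := by
    rw [hμ.cylinder, Finset.prod_range_succ']
    rfl
  rw [if_pos rfl, one_mul] at h1
  rw [mul_comm, ← h1]
  refine measure_congr ?_
  filter_upwards [hμ.ae_start x] with ω hω
  refine propext ⟨fun h k hk => ?_, fun h k hk => h (k + 1) (Nat.succ_le_succ hk)⟩
  cases k with
  | zero => exact hω
  | succ k => exact h k (Nat.le_of_succ_le_succ hk)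

lemma IsSRW4.map_shift (hμ : IsSRW4 μ) (x : V4) :
    (μ x).map shiftPath = Measure.sum fun y => stepProb x y • μ y := by
  have := fun x => hμ.1 x
  have : IsProbabilityMeasure ((μ x).map shiftPath) :=
    Measure.isProbabilityMeasure_map measurable_shiftPath.aemeasurable
  have hcyl : ∀ n γ, (μ x).map shiftPath (pathCylinder n γ) =
      (Measure.sum fun y => stepProb x y • μ y) (pathCylinder n γ) := by
    intro n γ
    rw [hμ.cylinder_shift, Measure.sum_apply _ (measurableSet_pathCylinder n γ)]
    simp only [Measure.smul_apply, smul_eq_mul, hμ.cylinder]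
    rw [tsum_eq_single (γ 0) fun y hy => by rw [if_neg hy.symm]; simp]
    simp
  refine Measure.ext_of_generateFrom_of_cover_subset generateFrom_pathCylinder
    isPiSystem_pathCylinder (T := range fun y : V4 => pathCylinder 0 fun _ => y) ?_
    (countable_range _) ?_ (fun t _ => measure_ne_top _ t) ?_
  · rintro _ ⟨y, rfl⟩
    exact ⟨0, _, rfl⟩
  · ext ω
    simp [pathCylinder]
  · rintro _ ⟨n, γ, rfl⟩
    exact hcyl n γ

lemma IsSRW4.shift_apply (hμ : IsSRW4 μ) (x : V4) {S : Set (ℕ → V4)} (hS : MeasurableSet S) :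
    μ x (shiftPath ⁻¹' S) = ∑' y, stepProb x y * μ y S := by
  rw [← Measure.map_apply measurable_shiftPath hS, hμ.map_shift, Measure.sum_apply _ hS]
  rfl

/-- The probability of being at `y` at time `m` having stayed in `D` up to then. -/
def killedKernel (μ : V4 → Measure (ℕ → V4)) (D : Set V4) (m : ℕ) (x y : V4) : ℝ≥0∞ :=
  μ x {ω | (∀ k ≤ m, ω k ∈ D) ∧ ω m = y}

lemma measurableSet_stay (D : Set V4) (m : ℕ) :
    MeasurableSet {ω : ℕ → V4 | ∀ k ≤ m, ω k ∈ D} := by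
  have : {ω : ℕ → V4 | ∀ k ≤ m, ω k ∈ D} = ⋂ k, ⋂ (_ : k ≤ m), {ω | ω k ∈ D} := by
    ext ω; simp
  rw [this]
  exact MeasurableSet.iInter fun k => MeasurableSet.iInter fun _ => measurableSet_coord k _

lemma measurableSet_stay_eq (D : Set V4) (m : ℕ) (y : V4) :
    MeasurableSet {ω : ℕ → V4 | (∀ k ≤ m, ω k ∈ D) ∧ ω m = y} :=
  (measurableSet_stay D m).inter (measurableSet_coord_eq m y)

lemma measurableSet_markov (D : Set V4) (m : ℕ) (y : V4) {S : Set (ℕ → V4)}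
    (hS : MeasurableSet S) :
    MeasurableSet {ω : ℕ → V4 | (∀ k ≤ m, ω k ∈ D) ∧ ω m = y ∧ (fun k => ω (k + m)) ∈ S} :=
  (measurableSet_stay D m).inter
    ((measurableSet_coord_eq m y).inter (measurable_shiftPath_iterate m hS))

lemma IsSRW4.inter_shift (hμ : IsSRW4 μ) (x : V4) (D : Set V4) {S : Set (ℕ → V4)}
    (hS : MeasurableSet S) :
    μ x {ω | ω 0 ∈ D ∧ shiftPath ω ∈ S} =
      (if x ∈ D then 1 else 0) * ∑' y, stepProb x y * μ y S := by
  rw [← hμ.shift_apply x hS]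
  split_ifs with h
  · rw [one_mul]
    refine measure_congr ?_
    filter_upwards [hμ.ae_start x] with ω hω
    exact propext ⟨fun h' => h'.2, fun h' => ⟨by rwa [hω], h'⟩⟩
  · rw [zero_mul, measure_eq_zero_iff_ae_notMem]
    filter_upwards [hμ.ae_start x] with ω hω h'
    exact h (hω ▸ h'.1)

lemma stay_succ_iff (D : Set V4) (m : ℕ) (ω : ℕ → V4) :
    (∀ k ≤ m + 1, ω k ∈ D) ↔ ω 0 ∈ D ∧ ∀ k ≤ m, shiftPath ω k ∈ D := by
  constructor
  · exact fun h => ⟨h 0 (Nat.zero_le _), fun k hk => h (k + 1) (Nat.succ_le_succ hk)⟩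
  · rintro ⟨h0, h⟩ k hk
    cases k with
    | zero => exact h0
    | succ k => exact h k (Nat.le_of_succ_le_succ hk)

lemma IsSRW4.killedKernel_succ (hμ : IsSRW4 μ) (D : Set V4) (m : ℕ) (x y : V4) :
    killedKernel μ D (m + 1) x y =
      (if x ∈ D then 1 else 0) * ∑' z, stepProb x z * killedKernel μ D m z y := by
  rw [killedKernel]
  unfold killedKernel
  rw [← hμ.inter_shift x D (measurableSet_stay_eq D m y)]
  congr 1
  ext ω
  simp only [mem_ofPred_eq, stay_succ_iff, and_assoc]
  rfl

lemma IsSRW4.markov (hμ : IsSRW4 μ) (D : Set V4) (m : ℕ) (x y : V4) {S : Set (ℕ → V4)}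
    (hS : MeasurableSet S) :
    μ x {ω | (∀ k ≤ m, ω k ∈ D) ∧ ω m = y ∧ (fun k => ω (k + m)) ∈ S} =
      killedKernel μ D m x y * μ y S := by
  induction m generalizing x with
  | zero =>
    rw [killedKernel]
    by_cases h : x ∈ D ∧ x = y
    · have h1 : μ x {ω | (∀ k ≤ 0, ω k ∈ D) ∧ ω 0 = y} = 1 := by
        rw [← hμ.start x]
        refine measure_congr ?_
        filter_upwards [hμ.ae_start x] with ω hω
        refine propext ⟨fun _ => hω, fun _ => ⟨fun k hk => ?_, hω.trans h.2⟩⟩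
        rw [Nat.le_zero.1 hk, hω]
        exact h.1
      rw [h1, one_mul, ← h.2]
      refine measure_congr ?_
      filter_upwards [hμ.ae_start x] with ω hω
      refine propext ⟨fun h' => h'.2.2, fun h' => ⟨fun k hk => ?_, hω, h'⟩⟩
      rw [Nat.le_zero.1 hk, hω]
      exact h.1
    · have h1 : ∀ᵐ ω ∂(μ x), ¬((∀ k ≤ 0, ω k ∈ D) ∧ ω 0 = y) := by
        filter_upwards [hμ.ae_start x] with ω hω h'
        exact h ⟨hω ▸ h'.1 0 le_rfl, hω ▸ h'.2⟩
      have h2 : μ x {ω | (∀ k ≤ 0, ω k ∈ D) ∧ ω 0 = y} = 0 :=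
        measure_eq_zero_iff_ae_notMem.2 h1
      rw [h2, zero_mul]
      refine le_antisymm ((measure_mono ?_).trans h2.le) zero_le
      exact fun ω hω => ⟨hω.1, hω.2.1⟩
  | succ m ih =>
    rw [hμ.killedKernel_succ, mul_assoc, ← ENNReal.tsum_mul_right]
    simp_rw [mul_assoc, ← ih]
    rw [← hμ.inter_shift x D (measurableSet_markov D m y hS)]
    congr 1
    ext ω
    simp only [mem_ofPred_eq, stay_succ_iff, and_assoc]
    rfl

lemma latAdj_exists {x y : V4} (h : latAdj x y) :
    ∃ i : Fin 4, y = x + Pi.single i 1 ∨ y = x - Pi.single i 1 := by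
  unfold latAdj at h
  obtain ⟨i, hi⟩ : ∃ i, |x i - y i| ≠ 0 := by
    by_contra! h'
    simp [h'] at h
  rw [← Finset.add_sum_erase _ _ (Finset.mem_univ i)] at h
  have h0 := Finset.sum_nonneg fun j (_ : j ∈ Finset.univ.erase i) => abs_nonneg (x j - y j)
  have h1 := (abs_nonneg (x i - y i)).lt_of_ne' hi
  have h2 : ∑ j ∈ Finset.univ.erase i, |x j - y j| = 0 := by omega
  have h3 : |x i - y i| = 1 := by omega
  have h4 : ∀ j, j ≠ i → y j = x j := fun j hj => by
    have := (Finset.sum_eq_zero_iff_of_nonneg fun j _ => abs_nonneg _).1 h2 j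
      (Finset.mem_erase.2 ⟨hj, Finset.mem_univ j⟩)
    have := abs_eq_zero.1 this
    omega
  refine ⟨i, ?_⟩
  rcases (abs_eq zero_le_one).1 h3 with h5 | h5
  · right
    ext j
    by_cases hj : j = i
    · subst hj; simp; omega
    · simp [hj, h4 j hj]
  · left
    ext j
    by_cases hj : j = i
    · subst hj; simp; omega
    · simp [hj, h4 j hj]

lemma tsum_stepProb_le (x : V4) (f : V4 → ℝ≥0∞) :
    ∑' y, stepProb x y * f y ≤
      ∑ i : Fin 4, 8⁻¹ * (f (x + Pi.single i 1) + f (x - Pi.single i 1)) := by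
  calc ∑' y, stepProb x y * f y
      ≤ ∑' y, ∑ i : Fin 4, ((if y = x + Pi.single i 1 then 8⁻¹ * f y else 0) +
          (if y = x - Pi.single i 1 then 8⁻¹ * f y else 0)) := by
        refine ENNReal.tsum_le_tsum fun y => ?_
        rw [stepProb]
        split_ifs with h
        · obtain ⟨i, hi⟩ := latAdj_exists h
          refine le_trans ?_ (Finset.single_le_sum (fun _ _ => zero_le) (Finset.mem_univ i))
          rcases hi with hi | hi
          · rw [if_pos hi]; exact le_self_add
          · rw [if_pos hi]; exact le_add_self
        · simp
    _ = _ := by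
        rw [Summable.tsum_finsetSum fun i _ => ENNReal.summable]
        refine Finset.sum_congr rfl fun i _ => ?_
        rw [ENNReal.tsum_add, tsum_ite_eq, tsum_ite_eq, mul_add]

lemma IsSRW4.killedKernel_le_heat (hμ : IsSRW4 μ) (D : Set V4) (m : ℕ) (x y : V4) :
    killedKernel μ D m x y ≤ ENNReal.ofReal (heat m (x - y)) := by
  have := fun x => hμ.1 x
  induction m generalizing x with
  | zero =>
    rw [heat_zero]
    split_ifs with h
    · rw [ENNReal.ofReal_one]
      exact prob_le_one
    · rw [ENNReal.ofReal_zero, nonpos_iff_eq_zero, killedKernel, measure_eq_zero_iff_ae_notMem]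
      filter_upwards [hμ.ae_start x] with ω hω h'
      exact h (sub_eq_zero.2 (hω.symm.trans h'.2))
  | succ m ih =>
    rw [hμ.killedKernel_succ]
    refine (mul_le_of_le_one_left zero_le (by split_ifs <;> simp)).trans ?_
    refine (tsum_stepProb_le x _).trans ?_
    rw [heat_succ, ENNReal.ofReal_sum_of_nonneg fun i _ =>
      div_nonneg (add_nonneg (heat_nonneg _ _) (heat_nonneg _ _)) (by norm_num)]
    refine Finset.sum_le_sum fun i _ => ?_
    rw [div_eq_inv_mul, ENNReal.ofReal_mul (by norm_num),
      ENNReal.ofReal_add (heat_nonneg _ _) (heat_nonneg _ _),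
      ENNReal.ofReal_inv_of_pos (by norm_num), ENNReal.ofReal_ofNat]
    gcongr
    · rw [add_sub_right_comm x _ y |>.symm]; exact ih _
    · rw [sub_right_comm]; exact ih _

lemma IsSRW4.killedKernel_zero_self (hμ : IsSRW4 μ) {D : Set V4} {y : V4} (hy : y ∈ D) :
    killedKernel μ D 0 y y = 1 := by
  rw [killedKernel, ← hμ.start y]
  refine measure_congr ?_
  filter_upwards [hμ.ae_start y] with ω hω
  refine propext ⟨fun _ => hω, fun _ => ⟨fun k hk => ?_, hω⟩⟩
  rw [Nat.le_zero.1 hk, hω]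
  exact hy

/-- Paths that trace `γ` for `n` steps, performing at each `γ i` with `i < n` a loop of length
`l i` inside `D i` before stepping to `γ (i + 1)`. -/
def loopEvent : ℕ → (ℕ → V4) → (ℕ → Set V4) → (ℕ → ℕ) → Set (ℕ → V4)
  | 0, γ, _, _ => {ω | ω 0 = γ 0}
  | n + 1, γ, D, l => {ω | ω 0 = γ 0 ∧ (∀ k ≤ l 0, ω k ∈ D 0) ∧ ω (l 0) = γ 0 ∧
      (fun k => ω (k + l 0)) ∈ shiftPath ⁻¹'
        loopEvent n (fun i => γ (i + 1)) (fun i => D (i + 1)) (fun i => l (i + 1))}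

lemma measurableSet_loopEvent (n : ℕ) (γ : ℕ → V4) (D : ℕ → Set V4) (l : ℕ → ℕ) :
    MeasurableSet (loopEvent n γ D l) := by
  induction n generalizing γ D l with
  | zero => exact measurableSet_coord_eq 0 _
  | succ n ih =>
    exact (measurableSet_coord_eq 0 _).inter
      (measurableSet_markov (D 0) (l 0) (γ 0) (measurable_shiftPath (ih _ _ _)))

lemma loopEvent_start {n : ℕ} {γ : ℕ → V4} {D : ℕ → Set V4} {l : ℕ → ℕ} {ω : ℕ → V4}
    (h : ω ∈ loopEvent n γ D l) : ω 0 = γ 0 := by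
  cases n with
  | zero => exact h
  | succ n => exact h.1

lemma IsSRW4.measure_loopEvent (hμ : IsSRW4 μ) (n : ℕ) (γ : ℕ → V4) (D : ℕ → Set V4)
    (l : ℕ → ℕ) (hγ : ∀ k < n, latAdj (γ k) (γ (k + 1))) :
    μ (γ 0) (loopEvent n γ D l) =
      ∏ i ∈ Finset.range n, killedKernel μ (D i) (l i) (γ i) (γ i) * 8⁻¹ := by
  induction n generalizing γ D l with
  | zero => simpa [loopEvent] using hμ.start (γ 0)
  | succ n ih =>
    rw [Finset.prod_range_succ', ← ih (fun i => γ (i + 1)) (fun i => D (i + 1))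
      (fun i => l (i + 1)) fun k hk => hγ (k + 1) (Nat.succ_lt_succ hk)]
    set F := loopEvent n (fun i => γ (i + 1)) (fun i => D (i + 1)) (fun i => l (i + 1)) with hF
    have hFm : MeasurableSet F := measurableSet_loopEvent _ _ _ _
    have h1 : μ (γ 0) (loopEvent (n + 1) γ D l) =
        killedKernel μ (D 0) (l 0) (γ 0) (γ 0) * μ (γ 0) (shiftPath ⁻¹' F) := by
      rw [← hμ.markov (D 0) (l 0) (γ 0) (γ 0) (measurable_shiftPath hFm)]
      refine measure_congr ?_
      filter_upwards [hμ.ae_start (γ 0)] with ω hω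
      exact propext ⟨fun h => h.2, fun h => ⟨hω, h⟩⟩
    have h2 : μ (γ 0) (shiftPath ⁻¹' F) = 8⁻¹ * μ (γ 1) F := by
      rw [hμ.shift_apply _ hFm, tsum_eq_single (γ 1)]
      · rw [stepProb, if_pos (hγ 0 (Nat.succ_pos n))]
      · intro y hy
        have : μ y F = 0 := by
          rw [measure_eq_zero_iff_ae_notMem]
          filter_upwards [hμ.ae_start y] with ω hω h
          exact hy (hω.symm.trans (loopEvent_start h))
        rw [this, mul_zero]
    rw [h1, h2, zero_add, mul_comm (μ (γ 1) F), mul_assoc]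

end SimpleRandomWalk

/-! ### Loop decomposition of the stopped path -/

lemma mem_loopEvent_iff (n : ℕ) (γ : ℕ → V4) (D : ℕ → Set V4) (l : ℕ → ℕ) (ω : ℕ → V4) :
    ω ∈ loopEvent n γ D l ↔
      ω (∑ j ∈ Finset.range n, (l j + 1)) = γ n ∧
      ∀ i < n, ω (∑ j ∈ Finset.range i, (l j + 1)) = γ i ∧
        (∀ k ≤ l i, ω (k + ∑ j ∈ Finset.range i, (l j + 1)) ∈ D i) ∧
        ω (l i + ∑ j ∈ Finset.range i, (l j + 1)) = γ i := by
  induction n generalizing γ D l ω with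
  | zero => simp [loopEvent]
  | succ n ih =>
    have hs : ∀ m, ∑ j ∈ Finset.range (m + 1), (l j + 1) =
        ∑ j ∈ Finset.range m, (l (j + 1) + 1) + 1 + l 0 := fun m => by
      rw [Finset.sum_range_succ']; ring
    rw [loopEvent, mem_ofPred_eq, mem_preimage, ih]
    simp only [shiftPath, hs]
    constructor
    · rintro ⟨h0, hD, hl, hn, hi⟩
      refine ⟨hn, fun i hin => ?_⟩
      cases i with
      | zero => simpa using ⟨h0, hD, hl⟩
      | succ i =>
        simp only [hs, ← add_assoc]
        exact hi i (Nat.lt_of_succ_lt_succ hin)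
    · rintro ⟨hn, hi⟩
      have h0 := hi 0 (Nat.succ_pos n)
      simp only [Finset.range_zero, Finset.sum_empty, add_zero] at h0
      refine ⟨h0.1, h0.2.1, h0.2.2, hn, fun i hin => ?_⟩
      have := hi (i + 1) (Nat.succ_lt_succ hin)
      simpa only [hs, ← add_assoc] using this

lemma hitTime_le {A : Set V4} {ω : ℕ → V4} {k : ℕ} (h : ω k ∈ A) : hitTime A ω ≤ k :=
  iInf₂_le k h

lemma le_hitTime {A : Set V4} {ω : ℕ → V4} {m : ℕ∞} (h : ∀ k, ω k ∈ A → m ≤ k) :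
    m ≤ hitTime A ω :=
  le_iInf₂ h

lemma ellFin_mem {ω : ℕ → V4} {m i : ℕ} (h : ellFin ω m i ≤ m) :
    sSup {k | k ≤ m ∧ ω k = ω (ellFin ω m i)} ∈ {k | k ≤ m ∧ ω k = ω (ellFin ω m i)} :=
  Nat.sSup_mem ⟨_, h, rfl⟩ ⟨m, fun _ hk => hk.1⟩

lemma le_ellFin_succ {ω : ℕ → V4} {m i k : ℕ} (hk : k ≤ m) (h : ω k = ω (ellFin ω m i)) :
    k < ellFin ω m (i + 1) :=
  Nat.lt_succ_of_le (le_csSup ⟨m, fun _ hk => hk.1⟩ ⟨hk, h⟩)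

/-- The complement of `A ∪ B` and of the first `i` vertices of `γ`. -/
def avoidSet (A B : Set V4) (γ : ℕ → V4) (i : ℕ) : Set V4 :=
  {v | v ∉ A ∧ v ∉ B ∧ ∀ j < i, v ≠ γ j}

lemma exists_block (l : ℕ → ℕ) (n k : ℕ) (hk : k < ∑ j ∈ Finset.range n, (l j + 1)) :
    ∃ i < n, ∃ r ≤ l i, k = r + ∑ j ∈ Finset.range i, (l j + 1) := by
  induction n with
  | zero => simp at hk
  | succ n ih =>
    rcases lt_or_ge k (∑ j ∈ Finset.range n, (l j + 1)) with h | h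
    · obtain ⟨i, hi, r⟩ := ih h
      exact ⟨i, Nat.lt_succ_of_lt hi, r⟩
    · rw [Finset.sum_range_succ] at hk
      exact ⟨n, Nat.lt_succ_self n, k - ∑ j ∈ Finset.range n, (l j + 1), by omega, by omega⟩

lemma blockStart_mono (l : ℕ → ℕ) : Monotone fun i => ∑ j ∈ Finset.range i, (l j + 1) :=
  monotone_nat_of_le_succ fun n => by simp only [Finset.sum_range_succ]; omega

section Decomposition

variable {A B : Set V4} {n : ℕ} {γ : ℕ → V4} {ω : ℕ → V4}

lemma hitTime_of_mem_loopEvent (hA : γ n ∈ A) {l : ℕ → ℕ}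
    (h : ω ∈ loopEvent n γ (avoidSet A B γ) l) :
    hitTime A ω = (∑ j ∈ Finset.range n, (l j + 1) : ℕ) := by
  rw [mem_loopEvent_iff] at h
  refine le_antisymm (hitTime_le (by rw [h.1]; exact hA)) (le_hitTime fun k hk => ?_)
  by_contra! hlt
  obtain ⟨i, hi, r, hr, rfl⟩ := exists_block l n k (by exact_mod_cast hlt)
  exact ((h.2 i hi).2.1 r hr).1 hk

lemma ellFin_of_mem_loopEvent (hinj : ∀ i ≤ n, ∀ j ≤ n, γ i = γ j → i = j) {l : ℕ → ℕ}
    (h : ω ∈ loopEvent n γ (avoidSet A B γ) l) {i : ℕ} (hi : i ≤ n) :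
    ellFin ω (∑ j ∈ Finset.range n, (l j + 1)) i = ∑ j ∈ Finset.range i, (l j + 1) := by
  rw [mem_loopEvent_iff] at h
  induction i with
  | zero => rfl
  | succ i ih =>
    have hin : i < n := hi
    obtain ⟨h1, h2, h3⟩ := h.2 i hin
    have hmono := blockStart_mono l
    rw [ellFin, ih hin.le, Finset.sum_range_succ]
    have hgr : IsGreatest {k | k ≤ ∑ j ∈ Finset.range n, (l j + 1) ∧
        ω k = ω (∑ j ∈ Finset.range i, (l j + 1))} (l i + ∑ j ∈ Finset.range i, (l j + 1)) := by
      refine ⟨⟨?_, by rw [h3, h1]⟩, fun k ⟨hk, hk'⟩ => ?_⟩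
      · have := hmono hi
        simp only [Finset.sum_range_succ] at this
        omega
      · rw [h1] at hk'
        rcases hk.lt_or_eq with hlt | heq
        · obtain ⟨p, hp, r, hr, rfl⟩ := exists_block l n k hlt
          rcases lt_trichotomy p i with hpi | rfl | hpi
          · have := hmono (Nat.succ_le_of_lt hpi)
            simp only [Nat.succ_eq_add_one, Finset.sum_range_succ] at this
            omega
          · omega
          · exact absurd hk' (((h.2 p hp).2.1 r hr).2.2 i hpi)
        · rw [heq, h.1] at hk'
          exact absurd (hinj n le_rfl i hin.le hk') (by omega)
    rw [hgr.csSup_eq]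
    ring

lemma loopEvent_subset_leEvent (hinj : ∀ i ≤ n, ∀ j ≤ n, γ i = γ j → i = j)
    (hA : γ n ∈ A) (hB : ∀ k ≤ n, γ k ∉ B) {l : ℕ → ℕ}
    (h : ω ∈ loopEvent n γ (avoidSet A B γ) l) : ω ∈ leEvent A B n γ := by
  have hτ := hitTime_of_mem_loopEvent hA h
  have hell := fun i hi => ellFin_of_mem_loopEvent hinj h (i := i) hi
  have hd := (mem_loopEvent_iff _ _ _ _ _).1 h
  have hmono := blockStart_mono l
  refine ⟨by rw [hτ]; exact ENat.natCast_ne_top _, ?_, ?_, ?_⟩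
  · rw [hτ]
    have : ((∑ j ∈ Finset.range n, (l j + 1) : ℕ) : ℕ∞) + 1 ≤ hitTime B ω := by
      refine le_hitTime fun k hk => ?_
      by_contra! hlt
      have hlt' : k < ∑ j ∈ Finset.range n, (l j + 1) + 1 := by exact_mod_cast hlt
      rcases (Nat.le_of_lt_succ hlt').lt_or_eq with hlt'' | heq
      · obtain ⟨i, hi, r, hr, rfl⟩ := exists_block l n k hlt''
        exact ((hd.2 i hi).2.1 r hr).2.1 hk
      · rw [heq, hd.1] at hk
        exact hB n le_rfl hk
    exact (ENat.add_one_le_iff (ENat.natCast_ne_top _)).1 this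
  · rw [hτ, ENat.toNat_natCast, leLen]
    have hmem : n ∈ {i | ellFin ω (∑ j ∈ Finset.range n, (l j + 1)) (i + 1) =
        ∑ j ∈ Finset.range n, (l j + 1) + 1} := by
      simp only [mem_ofPred_eq]
      rw [ellFin, hell n le_rfl]
      congr 1
      exact IsGreatest.csSup_eq ⟨⟨le_rfl, rfl⟩, fun k hk => hk.1⟩
    refine le_antisymm (Nat.sInf_le hmem) (le_csInf ⟨n, hmem⟩ fun i hi => ?_)
    by_contra! hlt
    rw [mem_ofPred_eq, hell (i + 1) hlt] at hi
    have := hmono (Nat.succ_le_of_lt hlt)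
    simp only [Nat.succ_eq_add_one] at this
    omega
  · intro i hi
    rw [hτ, ENat.toNat_natCast, hell i hi]
    rcases hi.lt_or_eq with hlt | rfl
    · exact (hd.2 i hlt).1
    · exact hd.1

/-- The length of the loop erased at the `i`-th vertex of the loop-erasure of `ω` stopped when
hitting `A`. -/
def loopLength (A : Set V4) (ω : ℕ → V4) (i : ℕ) : ℕ :=
  ellFin ω (hitTime A ω).toNat (i + 1) - ellFin ω (hitTime A ω).toNat i - 1

lemma loopLength_of_mem_loopEvent (hinj : ∀ i ≤ n, ∀ j ≤ n, γ i = γ j → i = j)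
    (hA : γ n ∈ A) {l : ℕ → ℕ} (h : ω ∈ loopEvent n γ (avoidSet A B γ) l) {i : ℕ} (hi : i < n) :
    loopLength A ω i = l i := by
  rw [loopLength, hitTime_of_mem_loopEvent hA h, ENat.toNat_natCast,
    ellFin_of_mem_loopEvent hinj h hi, ellFin_of_mem_loopEvent hinj h hi.le,
    Finset.sum_range_succ]
  omega

lemma mem_loopEvent_of_mem_leEvent (h : ω ∈ leEvent A B n γ) :
    ω ∈ loopEvent n γ (avoidSet A B γ) (loopLength A ω) := by
  obtain ⟨hfin, hlt, hlen, hγ⟩ := h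
  set m := (hitTime A ω).toNat with hm
  have hτ : hitTime A ω = m := (ENat.natCast_toNat hfin).symm
  have havoidA : ∀ k < m, ω k ∉ A := fun k hk hmem => by
    have := hitTime_le hmem
    rw [hτ] at this
    have : m ≤ k := by exact_mod_cast this
    omega
  have havoidB : ∀ k < m, ω k ∉ B := fun k hk hmem => by
    have h1 := hlt.trans_le (hitTime_le hmem)
    rw [hτ] at h1
    have : m < k := by exact_mod_cast h1
    omega
  have hle : ∀ i ≤ n, ellFin ω m i ≤ m := by
    intro i hi
    induction i with
    | zero => exact Nat.zero_le _
    | succ i ih =>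
      have h1 := (ellFin_mem (ih (by omega))).1
      have h2 : ellFin ω m (i + 1) ≠ m + 1 :=
        Nat.notMem_of_lt_sInf (s := {i | ellFin ω m (i + 1) = m + 1}) (by
          change i < leLen ω m
          omega)
      rw [ellFin] at h2 ⊢
      omega
  have hstep : ∀ i < n, ellFin ω m i < ellFin ω m (i + 1) := fun i hi =>
    le_ellFin_succ (hle i hi.le) rfl
  have hsum : ∀ i ≤ n, ∑ j ∈ Finset.range i, (loopLength A ω j + 1) = ellFin ω m i := by
    intro i hi
    induction i with
    | zero => rfl
    | succ i ih =>
      rw [Finset.sum_range_succ, ih (by omega), loopLength, ← hm]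
      have := hstep i hi
      omega
  have hmono : ∀ j i, j ≤ i → i ≤ n → ellFin ω m j ≤ ellFin ω m i := by
    intro j i hji hin
    rw [← hsum i hin, ← hsum j (hji.trans hin)]
    exact blockStart_mono _ hji
  rw [mem_loopEvent_iff]
  refine ⟨by rw [hsum n le_rfl]; exact hγ n le_rfl, fun i hi => ?_⟩
  have hi' := hstep i hi
  have hlast : loopLength A ω i + ellFin ω m i =
      sSup {k | k ≤ m ∧ ω k = ω (ellFin ω m i)} := by
    rw [loopLength, ← hm]
    have : ellFin ω m (i + 1) = sSup {k | k ≤ m ∧ ω k = ω (ellFin ω m i)} + 1 := rfl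
    omega
  rw [hsum i hi.le]
  refine ⟨hγ i hi.le, fun k hk => ?_, ?_⟩
  · have hkm : k + ellFin ω m i < m := by
      have h1 := hle (i + 1) hi
      rw [loopLength, ← hm] at hk
      omega
    refine ⟨havoidA _ hkm, havoidB _ hkm, fun j hj hjk => ?_⟩
    have h1 := le_ellFin_succ (ω := ω) (i := j) hkm.le (by rw [hjk, hγ j (by omega)])
    have h2 := hmono (j + 1) i hj hi.le
    omega
  · rw [hlast, (ellFin_mem (hle i hi.le)).2, hγ i hi.le]

end Decomposition

/-! ### Concentration of sums of independent variables with quadratic tails -/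

lemma sum_range_min_sq_le {K : ℝ} (hK : 1 ≤ K) (N : ℕ) :
    ∑ k ∈ Finset.range N, min ((k : ℝ) + 1) K ^ 2 / ((k : ℝ) + 1) ^ 2 ≤
      4 * K - 4 * K ^ 2 / (N + K) := by
  induction N with
  | zero =>
    have : K ≠ 0 := by positivity
    simp only [Finset.range_zero, Finset.sum_empty, Nat.cast_zero, zero_add]
    rw [show 4 * K ^ 2 / K = 4 * K by field_simp]
    simp
  | succ N ih =>
    rw [Finset.sum_range_succ]
    have hN : (0 : ℝ) ≤ N := Nat.cast_nonneg N
    have hmin : min ((N : ℝ) + 1) K ≤ 2 * ((N : ℝ) + 1) * K / (N + 1 + K) := by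
      rw [le_div_iff₀ (by positivity)]
      rcases le_total ((N : ℝ) + 1) K with h | h
      · rw [min_eq_left h]; nlinarith
      · rw [min_eq_right h]; nlinarith
    have h0 : 0 ≤ min ((N : ℝ) + 1) K := le_min (by positivity) (by positivity)
    have h1 : min ((N : ℝ) + 1) K ^ 2 / ((N : ℝ) + 1) ^ 2 ≤ 4 * K ^ 2 / (N + 1 + K) ^ 2 := by
      rw [div_le_iff₀ (by positivity)]
      refine (pow_le_pow_left₀ h0 hmin 2).trans (le_of_eq ?_)
      field_simp
      ring
    have h2 : 4 * K ^ 2 / ((N : ℝ) + 1 + K) ^ 2 ≤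
        4 * K ^ 2 / (N + K) - 4 * K ^ 2 / (N + 1 + K) := by
      rw [div_sub_div _ _ (by positivity) (by positivity),
        div_le_div_iff₀ (by positivity) (by positivity)]
      have : 4 * K ^ 2 * ((N : ℝ) + 1 + K) - (N + K) * (4 * K ^ 2) = 4 * K ^ 2 := by ring
      rw [this]
      have hK2 : 0 ≤ 4 * K ^ 2 := by positivity
      refine mul_le_mul_of_nonneg_left ?_ hK2
      nlinarith
    push_cast
    linarith

lemma integrable_comp_of_bounded {Ω : Type*} [MeasurableSpace Ω] [DiscreteMeasurableSpace Ω]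
    (ν : Measure Ω) [IsFiniteMeasure ν] (f : Ω → ℝ) (M : ℝ) (hf : ∀ k, |f k| ≤ M) :
    Integrable f ν :=
  Integrable.of_bound (Measurable.of_discrete.aestronglyMeasurable) M
    (Eventually.of_forall hf)

lemma integral_min_sq_le {C₀ : ℝ} (hC : 0 < C₀) (ν : Measure ℕ) [IsProbabilityMeasure ν]
    (hν : ∀ k, ν.real {k} ≤ C₀ / ((k : ℝ) + 1) ^ 2) {K : ℝ} (hK : 1 ≤ K) :
    ∫ k, min ((k : ℝ) + 1) K ^ 2 ∂ν ≤ 4 * C₀ * K := by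
  have h0 : ∀ k : ℕ, 0 ≤ min ((k : ℝ) + 1) K := fun k =>
    le_min (by positivity) (by positivity)
  rw [integral_countable (integrable_comp_of_bounded ν _ (K ^ 2) fun k => by
    rw [abs_of_nonneg (by positivity)]
    exact pow_le_pow_left₀ (h0 k) (min_le_right _ _) 2)]
  refine Real.tsum_le_of_sum_range_le (fun k => by positivity) fun N => ?_
  calc ∑ k ∈ Finset.range N, ν.real {k} • min ((k : ℝ) + 1) K ^ 2
      ≤ ∑ k ∈ Finset.range N, C₀ * (min ((k : ℝ) + 1) K ^ 2 / ((k : ℝ) + 1) ^ 2) := by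
        refine Finset.sum_le_sum fun k _ => ?_
        rw [smul_eq_mul]
        refine (mul_le_mul_of_nonneg_right (hν k) (by positivity)).trans (le_of_eq ?_)
        ring
    _ ≤ C₀ * (4 * K) := by
        rw [← Finset.mul_sum]
        have h1 := sum_range_min_sq_le hK N
        have h2 : 0 ≤ 4 * K ^ 2 / (N + K) := by positivity
        gcongr
        linarith
    _ = 4 * C₀ * K := by ring

lemma integral_min_sub_min_le {C₀ : ℝ} (hC : 0 < C₀) (ν : Measure ℕ) [IsProbabilityMeasure ν]
    (hν : ∀ k, ν.real {k} ≤ C₀ / ((k : ℝ) + 1) ^ 2) {n lam : ℝ} (hn : 1 ≤ n) (hl : 1 ≤ lam) :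
    ∫ k, (min ((k : ℝ) + 1) (lam * n) - min ((k : ℝ) + 1) n) ∂ν ≤ 8 * C₀ * √lam := by
  have hln : n ≤ lam * n := by nlinarith
  have hK : 1 ≤ lam * n := hn.trans hln
  have hs : 0 < √lam := Real.sqrt_pos.2 (by linarith)
  have hs2 : √lam * √lam = lam := Real.mul_self_sqrt (by linarith)
  have h0 : ∀ k : ℕ, ∀ K : ℝ, 1 ≤ K → 0 ≤ min ((k : ℝ) + 1) K := fun k K hK =>
    le_min (by positivity) (by positivity)
  have hint : ∀ K : ℝ, 1 ≤ K → Integrable (fun k : ℕ => min ((k : ℝ) + 1) K) ν := fun K hK =>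
    integrable_comp_of_bounded ν _ K fun k => by
      rw [abs_of_nonneg (h0 k K hK)]; exact min_le_right _ _
  have hint2 : ∀ K : ℝ, 1 ≤ K → Integrable (fun k : ℕ => min ((k : ℝ) + 1) K ^ 2) ν :=
    fun K hK => integrable_comp_of_bounded ν _ (K ^ 2) fun k => by
      rw [abs_of_nonneg (by positivity)]
      exact pow_le_pow_left₀ (h0 k K hK) (min_le_right _ _) 2
  calc ∫ k, (min ((k : ℝ) + 1) (lam * n) - min ((k : ℝ) + 1) n) ∂ν
      ≤ ∫ k, ((n * √lam)⁻¹ * min ((k : ℝ) + 1) (lam * n) ^ 2 +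
          (√lam / n) * min ((k : ℝ) + 1) n ^ 2) ∂ν := by
        refine integral_mono ((hint _ hK).sub (hint _ hn))
          (((hint2 _ hK).const_mul _).add ((hint2 _ hn).const_mul _)) fun k => ?_
        simp only
        set Y := min ((k : ℝ) + 1) (lam * n) with hY
        rcases le_total ((k : ℝ) + 1) n with h | h
        · have : Y = (k : ℝ) + 1 := min_eq_left (h.trans hln)
          rw [min_eq_left h, this, sub_self]
          positivity
        · rw [min_eq_right h]
          have ha : 0 < n * √lam := by positivity
          have h2 : √lam / n * n ^ 2 = n * √lam := by field_simp
          rw [h2]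
          have h3 : Y ≤ (n * √lam)⁻¹ * Y ^ 2 + n * √lam := by
            have h4 : (n * √lam)⁻¹ * Y ^ 2 + n * √lam =
              (Y ^ 2 + (n * √lam) ^ 2) / (n * √lam) := by field_simp
            rw [h4, le_div_iff₀ ha]
            nlinarith [sq_nonneg (Y - n * √lam), sq_nonneg Y, sq_nonneg (n * √lam)]
          linarith
    _ ≤ (n * √lam)⁻¹ * (4 * C₀ * (lam * n)) + (√lam / n) * (4 * C₀ * n) := by
        rw [integral_add ((hint2 _ hK).const_mul _) ((hint2 _ hn).const_mul _),
          integral_const_mul, integral_const_mul]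
        have h1 := integral_min_sq_le hC ν hν hK
        have h2 := integral_min_sq_le hC ν hν hn
        gcongr
    _ = 8 * C₀ * √lam := by
        have h3 : lam * n = n * √lam * √lam := by rw [mul_assoc, hs2]; ring
        rw [h3]
        field_simp
        ring

lemma measureReal_tail_le {C₀ : ℝ} (hC : 0 < C₀) (ν : Measure ℕ) [IsProbabilityMeasure ν]
    (hν : ∀ k, ν.real {k} ≤ C₀ / ((k : ℝ) + 1) ^ 2) {K : ℝ} (hK : 1 ≤ K) :
    ν.real {k : ℕ | K < (k : ℝ) + 1} ≤ 4 * C₀ / K := by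
  have h0 : ∀ k : ℕ, 0 ≤ min ((k : ℝ) + 1) K := fun k =>
    le_min (by positivity) (by positivity)
  have h1 := mul_meas_ge_le_integral_of_nonneg (μ := ν)
    (f := fun k : ℕ => min ((k : ℝ) + 1) K ^ 2)
    (Eventually.of_forall fun k => by positivity)
    (integrable_comp_of_bounded ν _ (K ^ 2) fun k => by
      rw [abs_of_nonneg (by positivity)]
      exact pow_le_pow_left₀ (h0 k) (min_le_right _ _) 2) (K ^ 2)
  have h2 := integral_min_sq_le hC ν hν hK
  have h3 : ν.real {k : ℕ | K < (k : ℝ) + 1} ≤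
      ν.real {k : ℕ | K ^ 2 ≤ min ((k : ℝ) + 1) K ^ 2} := by
    refine measureReal_mono fun k hk => ?_
    simp only [mem_ofPred_eq] at hk ⊢
    rw [min_eq_right hk.le]
  rw [le_div_iff₀ (by positivity)]
  have h4 : 0 < K := by positivity
  have h5 : K * (ν.real {k : ℕ | K < (k : ℝ) + 1} * K) ≤ K * (4 * C₀) := by
    nlinarith [mul_le_mul_of_nonneg_left h3 (sq_nonneg K)]
  exact le_of_mul_le_mul_left h5 h4

lemma pi_concentration {C₀ : ℝ} (hC : 0 < C₀) {n : ℕ} (hn : 0 < n) (ν : Fin n → Measure ℕ)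
    [∀ i, IsProbabilityMeasure (ν i)]
    (hν : ∀ i k, (ν i).real {k} ≤ C₀ / ((k : ℝ) + 1) ^ 2) {lam : ℝ} (hl : 1 ≤ lam) :
    (Measure.pi ν).real {l | lam * n < |∑ i, ((l i : ℝ) + 1) -
        ∫ l, ∑ i, min ((l i : ℝ) + 1) n ∂(Measure.pi ν)|} ≤
      (20 * C₀ + 256 * C₀ ^ 2) / lam := by
  have hn1 : (1 : ℝ) ≤ n := by exact_mod_cast hn
  have hl0 : 0 < lam := by linarith
  have hs : 0 < √lam := Real.sqrt_pos.2 hl0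
  have hs2 : √lam * √lam = lam := Real.mul_self_sqrt hl0.le
  set K : ℝ := lam * n with hKdef
  have hK : 1 ≤ K := by nlinarith
  rcases le_or_gt (√lam) (16 * C₀) with hsmall | hbig
  · refine measureReal_le_one.trans ?_
    rw [le_div_iff₀ hl0]
    nlinarith
  have h0 : ∀ k : ℕ, ∀ K : ℝ, 1 ≤ K → 0 ≤ min ((k : ℝ) + 1) K := fun k K hK =>
    le_min (by positivity) (by positivity)
  have hbd : ∀ K : ℝ, 1 ≤ K → ∀ k : ℕ, |min ((k : ℝ) + 1) K| ≤ K := fun K hK k => by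
    rw [abs_of_nonneg (h0 k K hK)]; exact min_le_right _ _
  have hcoord : ∀ (i : Fin n) (f : ℕ → ℝ),
      ∫ l, f (l i) ∂(Measure.pi ν) = ∫ k, f k ∂(ν i) := fun i f =>
    integral_comp_eval (μ := ν) (i := i) (Measurable.of_discrete (f := f)).aestronglyMeasurable
  have hint : ∀ K : ℝ, 1 ≤ K → ∀ i : Fin n,
      Integrable (fun l : Fin n → ℕ => min ((l i : ℝ) + 1) K) (Measure.pi ν) := fun K hK i =>
    integrable_comp_of_bounded _ _ K fun l => hbd K hK (l i)
  set Y : Fin n → (Fin n → ℕ) → ℝ := fun i l => min ((l i : ℝ) + 1) K with hY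
  have hmem : ∀ i, MemLp (Y i) 2 (Measure.pi ν) := fun i =>
    MemLp.of_bound (Measurable.of_discrete.aestronglyMeasurable) K
      (Eventually.of_forall fun l => hbd K hK (l i))
  have hind : ProbabilityTheory.iIndepFun Y (Measure.pi ν) :=
    ProbabilityTheory.iIndepFun_pi (X := fun _ (k : ℕ) => min ((k : ℝ) + 1) K)
      fun i => Measurable.of_discrete.aemeasurable
  have hvar : ProbabilityTheory.variance (∑ i, Y i) (Measure.pi ν) ≤ n * (4 * C₀ * K) := by
    rw [ProbabilityTheory.IndepFun.variance_sum (fun i _ => hmem i)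
      fun i _ j _ hij => hind.indepFun hij]
    calc ∑ i, ProbabilityTheory.variance (Y i) (Measure.pi ν)
        ≤ ∑ _i : Fin n, 4 * C₀ * K := by
          refine Finset.sum_le_sum fun i _ => ?_
          refine (ProbabilityTheory.variance_le_expectation_sq
            (Measurable.of_discrete.aestronglyMeasurable)).trans ?_
          have := hcoord i fun k => min ((k : ℝ) + 1) K ^ 2
          refine le_of_eq_of_le ?_ (integral_min_sq_le hC (ν i) (hν i) hK)
          rw [← this]
          rfl
      _ = n * (4 * C₀ * K) := by simp
  have hmeanY : ∫ l, (∑ i, Y i) l ∂(Measure.pi ν) =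
      ∑ i, ∫ k, min ((k : ℝ) + 1) K ∂(ν i) := by
    simp only [Finset.sum_apply]
    rw [integral_finsetSum _ fun i _ => hint K hK i]
    exact Finset.sum_congr rfl fun i _ => hcoord i fun k => min ((k : ℝ) + 1) K
  have hmeanT : ∫ l, ∑ i, min ((l i : ℝ) + 1) n ∂(Measure.pi ν) =
      ∑ i, ∫ k, min ((k : ℝ) + 1) n ∂(ν i) := by
    rw [integral_finsetSum _ fun i _ => hint n hn1 i]
    exact Finset.sum_congr rfl fun i _ => hcoord i fun k => min ((k : ℝ) + 1) n
  have hshift : |∫ l, (∑ i, Y i) l ∂(Measure.pi ν) -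
      ∫ l, ∑ i, min ((l i : ℝ) + 1) n ∂(Measure.pi ν)| ≤ K / 2 := by
    rw [hmeanY, hmeanT, ← Finset.sum_sub_distrib]
    have hi : ∀ i, ∀ K : ℝ, 1 ≤ K → Integrable (fun k : ℕ => min ((k : ℝ) + 1) K) (ν i) :=
      fun i K hK => integrable_comp_of_bounded _ _ K (hbd K hK)
    have hterm : ∀ i, ∫ k, min ((k : ℝ) + 1) K ∂(ν i) - ∫ k, min ((k : ℝ) + 1) n ∂(ν i) =
        ∫ k, (min ((k : ℝ) + 1) (lam * n) - min ((k : ℝ) + 1) n) ∂(ν i) := fun i =>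
      (integral_sub (hi i K hK) (hi i n hn1)).symm
    rw [abs_of_nonneg]
    · calc _ ≤ ∑ _i : Fin n, 8 * C₀ * √lam := by
            refine Finset.sum_le_sum fun i _ => ?_
            rw [hterm]
            exact integral_min_sub_min_le hC (ν i) (hν i) hn1 hl
        _ = n * (8 * C₀ * √lam) := by simp
        _ ≤ K / 2 := by
            have : 8 * C₀ * √lam ≤ lam / 2 := by nlinarith
            rw [hKdef]
            nlinarith
    · refine Finset.sum_nonneg fun i _ => ?_
      rw [hterm]
      refine integral_nonneg fun k => sub_nonneg.2 (min_le_min_left _ ?_)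
      nlinarith
  have hsub : {l : Fin n → ℕ | lam * n < |∑ i, ((l i : ℝ) + 1) -
        ∫ l, ∑ i, min ((l i : ℝ) + 1) n ∂(Measure.pi ν)|} ⊆
      (⋃ i, {l | K < (l i : ℝ) + 1}) ∪
        {l | K / 2 ≤ |(∑ i, Y i) l - ∫ l, (∑ i, Y i) l ∂(Measure.pi ν)|} := by
    intro l hlm
    by_cases h : ∃ i, K < (l i : ℝ) + 1
    · exact Or.inl (mem_iUnion.2 h)
    · push Not at h
      right
      have hYl : (∑ i, Y i) l = ∑ i, ((l i : ℝ) + 1) := by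
        rw [Finset.sum_apply]
        exact Finset.sum_congr rfl fun i _ => min_eq_left (h i)
      simp only [mem_ofPred_eq] at hlm ⊢
      rw [hYl]
      have := abs_sub_le (∑ i, ((l i : ℝ) + 1)) (∫ l, (∑ i, Y i) l ∂(Measure.pi ν))
        (∫ l, ∑ i, min ((l i : ℝ) + 1) n ∂(Measure.pi ν))
      linarith
  have hcheb : (Measure.pi ν).real
      {l | K / 2 ≤ |(∑ i, Y i) l - ∫ l, (∑ i, Y i) l ∂(Measure.pi ν)|} ≤ 16 * C₀ / lam := by
    have h1 := ProbabilityTheory.meas_ge_le_variance_div_sq (μ := Measure.pi ν)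
      (X := ∑ i, Y i) (memLp_finsetSum' _ fun i _ => hmem i) (c := K / 2) (by positivity)
    have h2 : ProbabilityTheory.variance (∑ i, Y i) (Measure.pi ν) / (K / 2) ^ 2 ≤
        16 * C₀ / lam := by
      rw [div_le_div_iff₀ (by positivity) hl0]
      have : 16 * C₀ * (K / 2) ^ 2 = n * (4 * C₀ * K) * lam := by rw [hKdef]; ring
      rw [this]
      gcongr
    exact ENNReal.toReal_le_of_le_ofReal (by positivity)
      (h1.trans (ENNReal.ofReal_le_ofReal h2))
  have hunion : (Measure.pi ν).real (⋃ i, {l : Fin n → ℕ | K < (l i : ℝ) + 1}) ≤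
      4 * C₀ / lam := by
    refine (measureReal_iUnion_fintype_le _).trans ?_
    calc ∑ i, (Measure.pi ν).real {l : Fin n → ℕ | K < (l i : ℝ) + 1}
        ≤ ∑ _i : Fin n, 4 * C₀ / K := by
          refine Finset.sum_le_sum fun i _ => ?_
          refine le_of_eq_of_le ?_ (measureReal_tail_le hC (ν i) (hν i) hK)
          exact (measurePreserving_eval ν i).measureReal_preimage
            (MeasurableSet.of_discrete (s := {k : ℕ | K < (k : ℝ) + 1})).nullMeasurableSet
      _ = 4 * C₀ / lam := by
          simp only [Finset.sum_const, Finset.card_univ, Fintype.card_fin, nsmul_eq_mul, hKdef]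
          field_simp
  refine (measureReal_mono hsub).trans ((measureReal_union_le _ _).trans ?_)
  have hfin : 4 * C₀ / lam + 16 * C₀ / lam ≤ (20 * C₀ + 256 * C₀ ^ 2) / lam := by
    rw [← add_div]
    exact (div_le_div_iff_of_pos_right hl0).2 (by nlinarith [sq_nonneg C₀])
  linarith

/-! ### The law of the loop lengths -/

lemma loopEvent_congr {n : ℕ} {γ : ℕ → V4} {D : ℕ → Set V4} {l l' : ℕ → ℕ}
    (h : ∀ i < n, l i = l' i) : loopEvent n γ D l = loopEvent n γ D l' := by
  induction n generalizing γ D l l' with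
  | zero => rfl
  | succ n ih =>
    rw [loopEvent, loopEvent, h 0 (Nat.succ_pos n),
      ih fun i hi => h (i + 1) (Nat.succ_lt_succ hi)]

/-- The extension of a finite sequence by zero. -/
def extendZero {n : ℕ} (l : Fin n → ℕ) (j : ℕ) : ℕ := if h : j < n then l ⟨j, h⟩ else 0

lemma extendZero_val {n : ℕ} (l : Fin n → ℕ) (i : Fin n) : extendZero l i = l i := by
  simp [extendZero]

/-- The loop lengths as a vector, set to zero outside of `leEvent`. -/
def loopVector (A B : Set V4) (n : ℕ) (γ : ℕ → V4) (ω : ℕ → V4) (i : Fin n) : ℕ :=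
  if ω ∈ leEvent A B n γ then loopLength A ω i else 0

section LoopLaw

variable {A B : Set V4} {n : ℕ} {γ : ℕ → V4}

lemma leEvent_inter_loopVector (hinj : ∀ i ≤ n, ∀ j ≤ n, γ i = γ j → i = j)
    (hA : γ n ∈ A) (hB : ∀ k ≤ n, γ k ∉ B) (l : Fin n → ℕ) :
    loopVector A B n γ ⁻¹' {l} ∩ leEvent A B n γ =
      loopEvent n γ (avoidSet A B γ) (extendZero l) := by
  ext ω
  constructor
  · rintro ⟨hl, hE⟩
    have h := mem_loopEvent_of_mem_leEvent hE
    rwa [loopEvent_congr (l' := extendZero l)] at h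
    intro i hi
    have := congrFun (mem_singleton_iff.1 hl) ⟨i, hi⟩
    rw [loopVector, if_pos hE] at this
    rw [this, extendZero, dif_pos hi]
  · intro h
    have hE := loopEvent_subset_leEvent hinj hA hB h
    refine ⟨?_, hE⟩
    ext i
    rw [loopVector, if_pos hE, loopLength_of_mem_loopEvent hinj hA h i.2, extendZero_val]

lemma measurableSet_leEvent (hinj : ∀ i ≤ n, ∀ j ≤ n, γ i = γ j → i = j)
    (hA : γ n ∈ A) (hB : ∀ k ≤ n, γ k ∉ B) : MeasurableSet (leEvent A B n γ) := by
  have : leEvent A B n γ = ⋃ l, loopVector A B n γ ⁻¹' {l} ∩ leEvent A B n γ := by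
    ext ω; simp
  rw [this]
  refine MeasurableSet.iUnion fun l => ?_
  rw [leEvent_inter_loopVector hinj hA hB]
  exact measurableSet_loopEvent _ _ _ _

lemma measurable_loopVector (hinj : ∀ i ≤ n, ∀ j ≤ n, γ i = γ j → i = j)
    (hA : γ n ∈ A) (hB : ∀ k ≤ n, γ k ∉ B) : Measurable (loopVector A B n γ) := by
  have hE := measurableSet_leEvent hinj hA hB
  refine measurable_to_countable' fun l => ?_
  rw [← inter_union_compl (loopVector A B n γ ⁻¹' {l}) (leEvent A B n γ)]
  refine MeasurableSet.union ?_ ?_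
  · rw [leEvent_inter_loopVector hinj hA hB]
    exact measurableSet_loopEvent _ _ _ _
  · have hz : ∀ ω ∈ (leEvent A B n γ)ᶜ, loopVector A B n γ ω = fun _ => 0 := fun ω hω => by
      ext i
      exact if_neg hω
    by_cases h : l = fun _ => 0
    · convert hE.compl
      exact inter_eq_right.2 fun ω hω => (hz ω hω).trans h.symm
    · convert MeasurableSet.empty
      exact eq_empty_of_forall_notMem fun ω hω =>
        h ((mem_singleton_iff.1 hω.1).symm.trans (hz ω hω.2))

lemma hitTime_of_mem_leEvent (hA : γ n ∈ A) {ω : ℕ → V4} (h : ω ∈ leEvent A B n γ) :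
    ((hitTime A ω).toNat : ℝ) = ∑ i, ((loopVector A B n γ ω i : ℝ) + 1) := by
  rw [hitTime_of_mem_loopEvent hA (mem_loopEvent_of_mem_leEvent h), ENat.toNat_natCast,
    Finset.sum_range]
  simp [loopVector, h]

lemma sum_min_of_mem_leEvent (hinj : ∀ i ≤ n, ∀ j ≤ n, γ i = γ j → i = j)
    (hA : γ n ∈ A) {ω : ℕ → V4} (h : ω ∈ leEvent A B n γ) :
    (∑ i ∈ Finset.Icc 1 n,
      (min (ellFin ω (hitTime A ω).toNat i - ellFin ω (hitTime A ω).toNat (i - 1)) n : ℝ)) =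
      ∑ i, min ((loopVector A B n γ ω i : ℝ) + 1) n := by
  have hL := mem_loopEvent_of_mem_leEvent h
  have hτ : (hitTime A ω).toNat = ∑ j ∈ Finset.range n, (loopLength A ω j + 1) := by
    rw [hitTime_of_mem_loopEvent hA hL, ENat.toNat_natCast]
  have h1 : ∑ i, min ((loopVector A B n γ ω i : ℝ) + 1) n =
      ∑ i ∈ Finset.range n, min ((loopLength A ω i : ℝ) + 1) n := by
    rw [Finset.sum_range]
    simp [loopVector, h]
  rw [h1]
  refine Finset.sum_nbij' (fun i => i - 1) (fun i => i + 1) ?_ ?_ ?_ ?_ ?_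
  · intro i hi; simp only [Finset.mem_Icc, Finset.mem_range] at hi ⊢; omega
  · intro i hi; simp only [Finset.mem_Icc, Finset.mem_range] at hi ⊢; omega
  · intro i hi; simp only [Finset.mem_Icc] at hi; omega
  · intro i hi; omega
  · intro i hi
    obtain ⟨hi1, hin⟩ := Finset.mem_Icc.1 hi
    obtain ⟨i, rfl⟩ := Nat.exists_eq_add_of_le' hi1
    rw [hτ, ellFin_of_mem_loopEvent hinj hL hin,
      ellFin_of_mem_loopEvent hinj hL (by omega), Nat.add_sub_cancel, Finset.sum_range_succ]
    push_cast
    rw [add_sub_cancel_left]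

end LoopLaw

/-- The weight of a loop of length `k` at `γ i` followed by a step to `γ (i + 1)`. -/
def loopWeight (μ : V4 → Measure (ℕ → V4)) (A B : Set V4) (γ : ℕ → V4) (i k : ℕ) : ℝ≥0∞ :=
  killedKernel μ (avoidSet A B γ i) k (γ i) (γ i) * 8⁻¹

lemma IsSRW4.exists_loop_law {μ : V4 → Measure (ℕ → V4)} (hμ : IsSRW4 μ) :
    ∃ C₀ : ℝ, 0 < C₀ ∧ ∀ (A B : Set V4) (n : ℕ) (γ : ℕ → V4),
      (∀ i ≤ n, ∀ j ≤ n, γ i = γ j → i = j) →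
      (∀ k < n, latAdj (γ k) (γ (k + 1))) →
      γ n ∈ A → (∀ k < n, γ k ∉ A) → (∀ k ≤ n, γ k ∉ B) →
      ∃ ν : Fin n → PMF ℕ,
        (∀ i k, (ν i).toMeasure.real {k} ≤ C₀ / ((k : ℝ) + 1) ^ 2) ∧
        ((μ (γ 0))[|leEvent A B n γ]).map (loopVector A B n γ) =
          Measure.pi fun i => (ν i).toMeasure := by
  obtain ⟨C₀, hC, hheat⟩ := heat_origin_le
  refine ⟨C₀, hC, fun A B n γ hinj hadj hA hA' hB => ?_⟩
  have := fun x => hμ.1 x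
  have hker : ∀ i k, killedKernel μ (avoidSet A B γ i) k (γ i) (γ i) ≤
      ENNReal.ofReal (C₀ / ((k : ℝ) + 1) ^ 2) := fun i k => by
    refine (hμ.killedKernel_le_heat _ k _ _).trans ?_
    rw [sub_self]
    exact ENNReal.ofReal_le_ofReal (hheat k)
  have hlow : ∀ i : Fin n, (8 : ℝ≥0∞)⁻¹ ≤ ∑' k, loopWeight μ A B γ i k := fun i => by
    have hmem : γ i ∈ avoidSet A B γ i := by
      refine ⟨hA' i i.2, hB i i.2.le, fun j hj h => ?_⟩
      have := hinj i i.2.le j (hj.le.trans i.2.le) h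
      omega
    calc (8 : ℝ≥0∞)⁻¹ = loopWeight μ A B γ i 0 := by
          rw [loopWeight, hμ.killedKernel_zero_self hmem, one_mul]
      _ ≤ _ := ENNReal.le_tsum 0
  have hup : ∀ i : Fin n, ∑' k, loopWeight μ A B γ i k ≠ ∞ := fun i => by
    have hsum : Summable fun k : ℕ => C₀ / ((k : ℝ) + 1) ^ 2 := by
      have h1 := (summable_nat_add_iff 1).2 (Real.summable_one_div_nat_pow.2 one_lt_two)
      exact (h1.mul_left C₀).congr fun k => by push_cast; ring
    refine ne_top_of_le_ne_top hsum.tsum_ofReal_ne_top (ENNReal.tsum_le_tsum fun k => ?_)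
    refine le_trans ?_ (hker i k)
    exact mul_le_of_le_one_right zero_le (by simp)
  have hne : ∀ i : Fin n, ∑' k, loopWeight μ A B γ i k ≠ 0 := fun i h0 => by
    have := hlow i
    rw [h0] at this
    simp at this
  set ν : Fin n → PMF ℕ := fun i => PMF.normalize (fun k => loopWeight μ A B γ i k) (hne i) (hup i)
    with hν
  have hνs : ∀ i k, (ν i).toMeasure {k} =
      loopWeight μ A B γ i k * (∑' k, loopWeight μ A B γ i k)⁻¹ := fun i k => by
    rw [PMF.toMeasure_apply_singleton _ _ (measurableSet_singleton k), hν, PMF.normalize_apply]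
  refine ⟨ν, fun i k => ?_, ?_⟩
  · refine ENNReal.toReal_le_of_le_ofReal (by positivity) ?_
    rw [hνs]
    refine le_trans ?_ (hker i k)
    calc loopWeight μ A B γ i k * (∑' k, loopWeight μ A B γ i k)⁻¹
        ≤ loopWeight μ A B γ i k * 8 := by
          gcongr
          rw [ENNReal.inv_le_iff_inv_le]
          exact hlow i
      _ = _ := by
          rw [loopWeight, mul_assoc, ENNReal.inv_mul_cancel (by norm_num) (by norm_num), mul_one]
  · set E := leEvent A B n γ with hEdef
    have hE : MeasurableSet E := measurableSet_leEvent hinj hA hB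
    have hLm := measurable_loopVector hinj hA hB
    set c : ℝ≥0∞ := ∏ i : Fin n, ∑' k, loopWeight μ A B γ i k with hc
    have hc0 : c ≠ 0 := Finset.prod_ne_zero_iff.2 fun i _ => hne i
    have hct : c ≠ ∞ := ENNReal.prod_ne_top fun i _ => hup i
    have hmap : ((μ (γ 0)).restrict E).map (loopVector A B n γ) =
        c • Measure.pi fun i => (ν i).toMeasure := by
      refine Measure.ext_of_singleton fun l => ?_
      rw [Measure.map_apply hLm (measurableSet_singleton l),
        Measure.restrict_apply (hLm (measurableSet_singleton l)),
        leEvent_inter_loopVector hinj hA hB, hμ.measure_loopEvent _ _ _ _ hadj,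
        Finset.prod_range, Measure.smul_apply, Measure.pi_singleton, smul_eq_mul, hc,
        ← Finset.prod_mul_distrib]
      refine Finset.prod_congr rfl fun i _ => ?_
      rw [hνs, mul_left_comm, ENNReal.mul_inv_cancel (hne i) (hup i), mul_one, extendZero_val,
        loopWeight]
    have hPE : μ (γ 0) E = c := by
      have h1 := congrArg (fun m => m univ) hmap
      simpa [Measure.map_apply hLm MeasurableSet.univ] using h1
    rw [ProbabilityTheory.cond, Measure.map_smul, hmap, hPE, smul_smul,
      ENNReal.inv_mul_cancel hc0 hct, one_smul]

/-- **Concentration of hitting times around typical times** (Lemma 2.4): there is a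
universal constant `C` such that for every `x ∈ ℤ⁴`, disjoint `A, B ⊆ ℤ⁴` and simple path
`γ` of length `n` from `x` to `A` avoiding `B`,
`P_x(|τ_A - T_{A,B}(γ)| > λ n | τ_A < ∞, τ_A < τ_B, LE(X^{τ_A}) = γ) ≤ C/λ` for `λ ≥ 1`. -/
theorem typical_time_concentration
    (μ : V4 → Measure (ℕ → V4)) (hμ : IsSRW4 μ) :
    ∃ C : ℝ, 0 < C ∧
      ∀ (x : V4) (A B : Set V4), Disjoint A B →
        ∀ (n : ℕ) (γ : ℕ → V4),
          γ 0 = x →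
          (∀ i ≤ n, ∀ j ≤ n, γ i = γ j → i = j) →
          (∀ k < n, latAdj (γ k) (γ (k + 1))) →
          γ n ∈ A → (∀ k < n, γ k ∉ A) → (∀ k ≤ n, γ k ∉ B) →
          ∀ lam : ℝ, 1 ≤ lam →
            (μ x)[|leEvent A B n γ]
                {ω | lam * n < |((hitTime A ω).toNat : ℝ) - typicalTime μ x A B n γ|} ≤
              ENNReal.ofReal (C / lam) := by
  obtain ⟨C₀, hC, hlaw⟩ := hμ.exists_loop_law
  refine ⟨20 * C₀ + 256 * C₀ ^ 2, by positivity, ?_⟩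
  rintro x A B - n γ rfl hinj hadj hA hA' hB lam hlam
  obtain ⟨ν, hν, hmap⟩ := hlaw A B n γ hinj hadj hA hA' hB
  have hE := measurableSet_leEvent hinj hA hB
  have hLm := measurable_loopVector hinj hA hB
  set κ := (μ (γ 0))[|leEvent A B n γ] with hκ
  have hae : ∀ᵐ ω ∂κ, ω ∈ leEvent A B n γ := ProbabilityTheory.ae_cond_mem hE
  have hT : typicalTime μ (γ 0) A B n γ =
      ∫ l, ∑ i, min ((l i : ℝ) + 1) n ∂(Measure.pi fun i => (ν i).toMeasure) := by
    rw [← hmap, integral_map hLm.aemeasurable Measurable.of_discrete.aestronglyMeasurable,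
      typicalTime]
    refine integral_congr_ae ?_
    filter_upwards [hae] with ω hω
    exact sum_min_of_mem_leEvent hinj hA hω
  have hset : κ {ω | lam * n < |((hitTime A ω).toNat : ℝ) - typicalTime μ (γ 0) A B n γ|} =
      (Measure.pi fun i => (ν i).toMeasure) {l | lam * n < |∑ i, ((l i : ℝ) + 1) -
        ∫ l, ∑ i, min ((l i : ℝ) + 1) n ∂(Measure.pi fun i => (ν i).toMeasure)|} := by
    rw [← hT, ← hmap, Measure.map_apply hLm MeasurableSet.of_discrete]
    refine measure_congr ?_
    filter_upwards [hae] with ω hω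
    refine propext ?_
    change _ < |((hitTime A ω).toNat : ℝ) - _| ↔ _ < |∑ i, ((loopVector A B n γ ω i : ℝ) + 1) - _|
    rw [hitTime_of_mem_leEvent hA hω]
  rw [hset]
  rcases Nat.eq_zero_or_pos n with rfl | hn
  · simp
  · have := pi_concentration hC hn (fun i => (ν i).toMeasure) hν hlam
    exact (ENNReal.le_ofReal_iff_toReal_le (measure_ne_top _ _)
      (div_nonneg (by positivity) (by linarith))).2 this
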